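/- Suppose a CAT trajectory satisfies Assumption 1 with constants L, Δ_f ∈ (0,∞). Then for all k ∈ ℕ and all j ≥ k with ε_{j+1} ≥ ε_k/2: min{r_k·γ₂·(ω₂γ₂)^{j−k}, d_min(k)} ≤ ‖d_j‖, where d_min(k) := γ₂ω₁⁻¹C^{−1/2}L^{−1/2}ε_k^{1/2}. -/

import Mathlib

open scoped RealInnerProductSpace
open Filter

noncomputable section

/-- Application of the Hessian-based quadratic model's gradient:
`∇M_x(d) = ∇²f(x) d + ∇f(x)`. -/
def gradModel {n : ℕ} (f : EuclideanSpace ℝ (Fin n) → ℝ)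
    (x d : EuclideanSpace ℝ (Fin n)) : EuclideanSpace ℝ (Fin n) :=
  fderiv ℝ (gradient f) x d + gradient f x

/-- The quadratic model `M_x(d) = (1/2) dᵀ ∇²f(x) d + ∇f(x)ᵀ d`. -/
def modelVal {n : ℕ} (f : EuclideanSpace ℝ (Fin n) → ℝ)
    (x d : EuclideanSpace ℝ (Fin n)) : ℝ :=
  (1/2) * ⟪fderiv ℝ (gradient f) x d, d⟫ + ⟪gradient f x, d⟫

/-- The ratio `ρ̂` of actual to (modified) predicted reduction; equals `0` when the
denominator is `0` (division by zero convention). -/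
def rhoHat {n : ℕ} (θ : ℝ) (f : EuclideanSpace ℝ (Fin n) → ℝ)
    (x d : EuclideanSpace ℝ (Fin n)) : ℝ :=
  (f x - f (x + d)) /
    (-(modelVal f x d) + (θ/2) * min ‖gradient f x‖ ‖gradient f (x + d)‖ * ‖d‖)

/-- A CAT trajectory (Algorithm 1, with `σ = 0`): sequences of iterates `x`, directions `d`,
radii `r`, multipliers `δ`, gradient-norm estimates `ε` and thresholds `b` (in `(0,∞]`,
modeled as `EReal`), indexed from `k = 1`. -/
structure CATTraj {n : ℕ} (θ β ω₁ ω₂ γ₁ γ₂ γ₃ ξ : ℝ)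
    (f : EuclideanSpace ℝ (Fin n) → ℝ)
    (x d : ℕ → EuclideanSpace ℝ (Fin n))
    (r δ ε : ℕ → ℝ) (b : ℕ → EReal) : Prop where
  hf : ∀ y, DifferentiableAt ℝ f y
  hf' : ∀ y, DifferentiableAt ℝ (gradient f) y
  r_pos : ∀ k, 1 ≤ k → 0 < r k
  δ_nonneg : ∀ k, 1 ≤ k → 0 ≤ δ k
  ε_pos : ∀ k, 1 ≤ k → 0 < ε k
  b_pos : ∀ k, 1 ≤ k → 0 < b k
  sub_grad : ∀ k, 1 ≤ k → ‖gradModel f (x k) (d k) + δ k • d k‖ ≤ γ₁ * ε k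
  sub_comp : ∀ k, 1 ≤ k → γ₂ * δ k * r k ≤ δ k * ‖d k‖
  sub_rad : ∀ k, 1 ≤ k → ‖d k‖ ≤ r k
  sub_decr : ∀ k, 1 ≤ k → modelVal f (x k) (d k) ≤ -(γ₃ * (δ k / 2) * ‖d k‖ ^ 2)
  step_acc : ∀ k, 1 ≤ k → f (x k + d k) ≤ f (x k) → x (k+1) = x k + d k
  step_rej : ∀ k, 1 ≤ k → ¬ f (x k + d k) ≤ f (x k) → x (k+1) = x k
  radius_succ : ∀ k, 1 ≤ k → β ≤ rhoHat θ f (x k) (d k) →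
    r (k+1) = max (ω₂ * ‖d k‖) (r k)
  radius_fail : ∀ k, 1 ≤ k → ¬ β ≤ rhoHat θ f (x k) (d k) → r (k+1) = r k / ω₁
  eps_one : ε 1 = ‖gradient f (x 1)‖
  eps_succ_dec : ∀ k, 1 ≤ k → (f (x k + d k) : EReal) ≤ (f (x k) : EReal) + b k →
    ε (k+1) = min (ε k) ‖gradient f (x k + d k)‖
  eps_succ_keep : ∀ k, 1 ≤ k → ¬ ((f (x k + d k) : EReal) ≤ (f (x k) : EReal) + b k) →
    ε (k+1) = ε k
  b_lb : ∀ k, 1 ≤ k → ((ξ * ε k * ‖d k‖ : ℝ) : EReal) ≤ b k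

/-- Assumption 1: bounded optimality gap along the trajectory, and the two
Lipschitz-Hessian-type inequalities along the steps. -/
def Assumption1 {n : ℕ} (L Δf : ℝ) (f : EuclideanSpace ℝ (Fin n) → ℝ)
    (x d : ℕ → EuclideanSpace ℝ (Fin n)) : Prop :=
  ∀ k, 1 ≤ k →
    f (x 1) - f (x k) ≤ Δf ∧
    ‖gradient f (x k + d k)‖ ≤ ‖gradModel f (x k) (d k)‖ + (L/2) * ‖d k‖ ^ 2 ∧
    f (x k + d k) ≤ f (x k) + modelVal f (x k) (d k) + (L/6) * ‖d k‖ ^ 3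

/-- `c₁ := (2 + 3γ₃(1−β))/(6(γ₃(1−β) − βθ))`. -/
def c1Def (θ β γ₃ : ℝ) : ℝ := (2 + 3 * γ₃ * (1 - β)) / (6 * (γ₃ * (1 - β) - β * θ))

/-- `c₂ := γ₃(1−β)/(γ₃(1−β) − βθ)`. -/
def c2Def (θ β γ₃ : ℝ) : ℝ := γ₃ * (1 - β) / (γ₃ * (1 - β) - β * θ)

/-- `C := max{1/(3ξ), 2c₁/(1 − 2γ₁c₂)}`. -/
def CDef (θ β γ₃ γ₁ ξ : ℝ) : ℝ :=
  max (1 / (3 * ξ)) (2 * c1Def θ β γ₃ / (1 - 2 * γ₁ * c2Def θ β γ₃))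

/-- `d_min` as a function of the value `e = ε_k`:
`γ₂ ω₁⁻¹ C^{-1/2} L^{-1/2} e^{1/2}`. -/
def dminDef (γ₂ ω₁ C L e : ℝ) : ℝ :=
  γ₂ * ω₁⁻¹ * (Real.sqrt C)⁻¹ * (Real.sqrt L)⁻¹ * Real.sqrt e

/-- `d_max` as a function of the value `e = ε_k`: `(2ω₂/(βθ)) Δf / e`. -/
def dmaxDef (ω₂ β θ Δf e : ℝ) : ℝ := (2 * ω₂ / (β * θ)) * (Δf / e)

namespace CATTraj

variable {n : ℕ} {θ β ω₁ ω₂ γ₁ γ₂ γ₃ ξ L Δf : ℝ} {f : EuclideanSpace ℝ (Fin n) → ℝ}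
  {x d : ℕ → EuclideanSpace ℝ (Fin n)} {r δ ε : ℕ → ℝ} {b : ℕ → EReal}

theorem eps_succ_le (traj : CATTraj θ β ω₁ ω₂ γ₁ γ₂ γ₃ ξ f x d r δ ε b) {i : ℕ} (hi : 1 ≤ i) :
    ε (i + 1) ≤ ε i := by
  by_cases h : (f (x i + d i) : EReal) ≤ (f (x i) : EReal) + b i
  · exact (traj.eps_succ_dec i hi h).trans_le (min_le_left _ _)
  · exact (traj.eps_succ_keep i hi h).le

theorem eps_anti (traj : CATTraj θ β ω₁ ω₂ γ₁ γ₂ γ₃ ξ f x d r δ ε b) {i j : ℕ} (hi : 1 ≤ i)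
    (hij : i ≤ j) : ε j ≤ ε i := by
  induction j, hij using Nat.le_induction with
  | base => rfl
  | succ j hij ih => exact (traj.eps_succ_le (hi.trans hij)).trans ih

theorem eps_le_norm_gradient (traj : CATTraj θ β ω₁ ω₂ γ₁ γ₂ γ₃ ξ f x d r δ ε b) {i : ℕ}
    (hi : 1 ≤ i) : ε i ≤ ‖gradient f (x i)‖ := by
  induction i, hi using Nat.le_induction with
  | base => exact traj.eps_one.le
  | succ i hi ih =>
    by_cases h : f (x i + d i) ≤ f (x i)
    · have hb : (f (x i + d i) : EReal) ≤ (f (x i) : EReal) + b i :=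
        (EReal.coe_le_coe_iff.2 h).trans (le_add_of_nonneg_right (traj.b_pos i hi).le)
      rw [traj.eps_succ_dec i hi hb, traj.step_acc i hi h]
      exact min_le_right _ _
    · rw [traj.step_rej i hi h]
      exact (traj.eps_succ_le hi).trans ih

theorem norm_gradModel_le (traj : CATTraj θ β ω₁ ω₂ γ₁ γ₂ γ₃ ξ f x d r δ ε b) {i : ℕ}
    (hi : 1 ≤ i) : ‖gradModel f (x i) (d i)‖ ≤ γ₁ * ε i + δ i * ‖d i‖ := by
  have h := norm_sub_le (gradModel f (x i) (d i) + δ i • d i) (δ i • d i)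
  rw [add_sub_cancel_right, norm_smul, Real.norm_of_nonneg (traj.δ_nonneg i hi)] at h
  linarith [traj.sub_grad i hi]

theorem modelVal_nonpos (traj : CATTraj θ β ω₁ ω₂ γ₁ γ₂ γ₃ ξ f x d r δ ε b) (hγ₃ : 0 ≤ γ₃)
    {i : ℕ} (hi : 1 ≤ i) : modelVal f (x i) (d i) ≤ 0 := by
  have h := traj.δ_nonneg i hi
  have : 0 ≤ γ₃ * (δ i / 2) * ‖d i‖ ^ 2 := by positivity
  linarith [traj.sub_decr i hi]

/-- A step that increases `f` by at most the cubic term passes the threshold `b`, so the new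
gradient norm bounds `ε` from above. -/
theorem eps_succ_le_norm_gradient (traj : CATTraj θ β ω₁ ω₂ γ₁ γ₂ γ₃ ξ f x d r δ ε b)
    (hγ₃ : 0 ≤ γ₃) (hA : Assumption1 L Δf f x d) {i : ℕ} (hi : 1 ≤ i)
    (hsmall : L / 6 * ‖d i‖ ^ 2 ≤ ξ * ε i) : ε (i + 1) ≤ ‖gradient f (x i + d i)‖ := by
  have hM := traj.modelVal_nonpos hγ₃ hi
  have hf : f (x i + d i) ≤ f (x i) + ξ * ε i * ‖d i‖ := by
    nlinarith [(hA i hi).2.2, mul_le_mul_of_nonneg_right hsmall (norm_nonneg (d i))]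
  have hb : (f (x i + d i) : EReal) ≤ (f (x i) : EReal) + b i := by
    refine (EReal.coe_le_coe_iff.2 hf).trans ?_
    rw [EReal.coe_add]
    exact add_le_add le_rfl (traj.b_lb i hi)
  rw [traj.eps_succ_dec i hi hb]
  exact min_le_right _ _

/-- An unsuccessful step has its new gradient controlled by `ε` and the squared step length. -/
theorem mul_norm_gradient_le_of_rhoHat_lt
    (traj : CATTraj θ β ω₁ ω₂ γ₁ γ₂ γ₃ ξ f x d r δ ε b) (hθ : 0 < θ) (hβ : 0 < β ∧ β < 1)
    (hγ₃ : 0 ≤ γ₃) (hA : Assumption1 L Δf f x d) {i : ℕ} (hi : 1 ≤ i) (hd : 0 < ‖d i‖)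
    (hg : 0 < ‖gradient f (x i + d i)‖) (hρ : rhoHat θ f (x i) (d i) < β) :
    (γ₃ * (1 - β) - β * θ) * ‖gradient f (x i + d i)‖ ≤
      γ₃ * (1 - β) * (γ₁ * ε i) + (2 + 3 * γ₃ * (1 - β)) / 6 * (L * ‖d i‖ ^ 2) := by
  have hgx : 0 < ‖gradient f (x i)‖ := (traj.ε_pos i hi).trans_le (traj.eps_le_norm_gradient hi)
  have hM := traj.modelVal_nonpos hγ₃ hi
  have hmod := traj.sub_decr i hi
  have hgm := traj.norm_gradModel_le hi
  obtain ⟨-, hgrad, hval⟩ := hA i hi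
  set D := ‖d i‖
  set G := ‖gradient f (x i + d i)‖
  have hmin : 0 < min ‖gradient f (x i)‖ G := lt_min hgx hg
  have hden : 0 < -(modelVal f (x i) (d i)) + (θ / 2) * min ‖gradient f (x i)‖ G * D := by
    have : 0 < (θ / 2) * min ‖gradient f (x i)‖ G * D := by positivity
    linarith
  rw [rhoHat, div_lt_iff₀ hden] at hρ
  have hminG : β * (θ / 2 * min ‖gradient f (x i)‖ G * D) ≤ β * (θ / 2 * G * D) := by
    have := hβ.1
    gcongr
    exact min_le_right _ _
  have hδ : (1 - β) * (γ₃ * (δ i / 2) * D ^ 2) ≤ L / 6 * D ^ 3 + β * (θ / 2 * G * D) := by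
    nlinarith [mul_le_mul_of_nonneg_left hmod (sub_pos.2 hβ.2).le]
  have hδ' : (1 - β) * (γ₃ * (δ i / 2) * D) ≤ L / 6 * D ^ 2 + β * (θ / 2 * G) := by
    refine le_of_mul_le_mul_right ?_ hd
    linarith
  have ha : 0 ≤ γ₃ * (1 - β) := mul_nonneg hγ₃ (sub_pos.2 hβ.2).le
  have hG : G ≤ γ₁ * ε i + δ i * D + L / 2 * D ^ 2 := by linarith
  linarith [mul_le_mul_of_nonneg_left hG ha]

/-- While the gradient estimate stays above `e / 2`, a short step is successful and
comparable to the radius. -/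
theorem rhoHat_ge_and_radius_le_of_short_step
    (traj : CATTraj θ β ω₁ ω₂ γ₁ γ₂ γ₃ ξ f x d r δ ε b) (hθ : 0 < θ) (hβ : 0 < β ∧ β < 1)
    (hγ₃ : 0 < γ₃ ∧ γ₃ ≤ 1)
    (hγ₁ : 0 ≤ γ₁ ∧ γ₁ < (1/2) * (1 - β * θ / (γ₃ * (1 - β)))) (hξ : 0 < ξ) (hL : 0 < L)
    (hA : Assumption1 L Δf f x d) {i : ℕ} (hi : 1 ≤ i) {e : ℝ} (he : 0 < e)
    (hie : ε i ≤ e) (hei : e / 2 ≤ ε (i + 1))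
    (hshort : CDef θ β γ₃ γ₁ ξ * (L * ‖d i‖ ^ 2) < e) :
    β ≤ rhoHat θ f (x i) (d i) ∧ γ₂ * r i ≤ ‖d i‖ := by
  have hβ' : 0 < 1 - β := sub_pos.2 hβ.2
  have hβθ : 0 < β * θ := mul_pos hβ.1 hθ
  have ha : 0 < γ₃ * (1 - β) := mul_pos hγ₃.1 hβ'
  have ha1 : γ₃ * (1 - β) ≤ 1 := by nlinarith [hγ₃.1, hγ₃.2, hβ.1]
  have hγ : 2 * γ₁ * (γ₃ * (1 - β)) < γ₃ * (1 - β) - β * θ := by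
    have h := mul_lt_mul_of_pos_right hγ₁.2 ha
    have h2 : β * θ / (γ₃ * (1 - β)) * (γ₃ * (1 - β)) = β * θ := div_mul_cancel₀ _ ha.ne'
    linarith
  have hs : 0 < γ₃ * (1 - β) - β * θ := by
    have := hγ₁.1
    exact lt_of_le_of_lt (by positivity) hγ
  have hγhalf : γ₁ < 1 / 2 := by nlinarith
  set q := L * ‖d i‖ ^ 2 with hq
  have hq0 : 0 ≤ q := by positivity
  have hqξ : 1 / (3 * ξ) * q < e :=
    (mul_le_mul_of_nonneg_right (le_max_left _ _) hq0).trans_lt hshort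
  have hqc : 2 * c1Def θ β γ₃ / (1 - 2 * γ₁ * c2Def θ β γ₃) * q < e :=
    (mul_le_mul_of_nonneg_right (le_max_right _ _) hq0).trans_lt hshort
  rw [div_mul_eq_mul_div, one_mul, div_lt_iff₀ (by positivity)] at hqξ
  have hcc : 2 * c1Def θ β γ₃ / (1 - 2 * γ₁ * c2Def θ β γ₃) =
      (2 + 3 * γ₃ * (1 - β)) / 3 / (γ₃ * (1 - β) - β * θ - 2 * γ₁ * (γ₃ * (1 - β))) := by
    have hc2 : 1 - 2 * γ₁ * c2Def θ β γ₃ =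
        (γ₃ * (1 - β) - β * θ - 2 * γ₁ * (γ₃ * (1 - β))) / (γ₃ * (1 - β) - β * θ) := by
      rw [c2Def]
      field_simp
    rw [hc2, c1Def, div_div_eq_mul_div]
    congr 1
    field_simp
    ring
  rw [hcc, div_mul_eq_mul_div, div_lt_iff₀ (sub_pos.2 hγ)] at hqc
  have hG : e / 2 ≤ ‖gradient f (x i + d i)‖ := by
    refine hei.trans (traj.eps_succ_le_norm_gradient hγ₃.1.le hA hi ?_)
    nlinarith [traj.eps_succ_le hi]
  have hγε : γ₁ * ε i ≤ γ₁ * e := mul_le_mul_of_nonneg_left hie hγ₁.1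
  have hgm := traj.norm_gradModel_le hi
  have hgrad := (hA i hi).2.1
  have hδd : 0 < δ i * ‖d i‖ := by
    have hqe : q < (1 - 2 * γ₁) * e := by nlinarith [mul_nonneg hγ₁.1 he.le]
    nlinarith
  have hδ : 0 < δ i := pos_of_mul_pos_left hδd (norm_nonneg _)
  have hd : 0 < ‖d i‖ := pos_of_mul_pos_right hδd hδ.le
  refine ⟨?_, le_of_mul_le_mul_left (by linarith [traj.sub_comp i hi]) hδ⟩
  by_contra! hρ
  have h := traj.mul_norm_gradient_le_of_rhoHat_lt hθ hβ hγ₃.1.le hA hi hd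
    (by linarith) hρ
  nlinarith [mul_le_mul_of_nonneg_left hG hs.le, mul_le_mul_of_nonneg_left hγε ha.le]

theorem radius_div_le (traj : CATTraj θ β ω₁ ω₂ γ₁ γ₂ γ₃ ξ f x d r δ ε b) (hω₁ : 1 < ω₁)
    {i : ℕ} (hi : 1 ≤ i) : r i / ω₁ ≤ r (i + 1) := by
  by_cases h : β ≤ rhoHat θ f (x i) (d i)
  · rw [traj.radius_succ i hi h]
    exact (div_le_self (traj.r_pos i hi).le hω₁.le).trans (le_max_right _ _)
  · exact (traj.radius_fail i hi h).ge

end CATTraj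

/-- Lemma 2(iii): lower bound on the search-direction size while the
gradient estimate has not halved. -/
theorem direction_lower_bound {n : ℕ} (hn : 1 ≤ n) (θ β ω₁ ω₂ γ₁ γ₂ γ₃ ξ L Δf : ℝ)
    (hθ : 0 < θ ∧ θ < 1) (hβ : 0 < β ∧ β < 1)
    (hω₁ : 1 < ω₁) (hω₂ : ω₁ ≤ ω₂)
    (hγ₃ : 0 < γ₃ ∧ γ₃ ≤ 1) (hγ₂ : ω₁⁻¹ < γ₂ ∧ γ₂ ≤ 1)
    (hγ₁ : 0 ≤ γ₁ ∧ γ₁ < (1/2) * (1 - β * θ / (γ₃ * (1 - β))))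
    (hξ : 0 < ξ)
    (f : EuclideanSpace ℝ (Fin n) → ℝ)
    (x d : ℕ → EuclideanSpace ℝ (Fin n)) (r δ ε : ℕ → ℝ) (b : ℕ → EReal)
    (traj : CATTraj θ β ω₁ ω₂ γ₁ γ₂ γ₃ ξ f x d r δ ε b)
    (hL : 0 < L) (hΔf : 0 < Δf) (hA : Assumption1 L Δf f x d) :
    ∀ k : ℕ, 1 ≤ k → ∀ j : ℕ, k ≤ j → ε k / 2 ≤ ε (j+1) →
      min (r k * γ₂ * (ω₂ * γ₂) ^ (j - k))
          (dminDef γ₂ ω₁ (CDef θ β γ₃ γ₁ ξ) L (ε k)) ≤ ‖d j‖ := by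
  intro k hk j hkj hε
  have hω₁0 : 0 < ω₁ := one_pos.trans hω₁
  have hγ₂0 : 0 < γ₂ := (inv_pos.2 hω₁0).trans hγ₂.1
  have hω₂γ₂ : 1 ≤ ω₂ * γ₂ := by
    have h := mul_lt_mul_of_pos_left hγ₂.1 hω₁0
    rw [mul_inv_cancel₀ hω₁0.ne'] at h
    nlinarith
  have hC : 0 < CDef θ β γ₃ γ₁ ξ := lt_max_of_lt_left (by positivity)
  have hεk : 0 < ε k := traj.ε_pos k hk
  set C := CDef θ β γ₃ γ₁ ξ with hCdef
  set D := (√C)⁻¹ * (√L)⁻¹ * √(ε k) with hD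
  have hD0 : 0 < D := by positivity
  have hDsq : C * (L * D ^ 2) = ε k := by
    rw [hD, mul_pow, mul_pow, inv_pow, inv_pow, Real.sq_sqrt hC.le, Real.sq_sqrt hL.le,
      Real.sq_sqrt hεk.le]
    field_simp
  have hdmin : dminDef γ₂ ω₁ C L (ε k) = γ₂ * (D / ω₁) := by
    rw [dminDef, hD]
    ring
  rw [hdmin]
  have hshort : ∀ i, k ≤ i → i ≤ j → ‖d i‖ < D →
      β ≤ rhoHat θ f (x i) (d i) ∧ γ₂ * r i ≤ ‖d i‖ := by
    intro i hki hij hdi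
    refine traj.rhoHat_ge_and_radius_le_of_short_step hθ.1 hβ hγ₃ hγ₁ hξ hL hA (hk.trans hki) hεk
      (traj.eps_anti hk hki)
      (hε.trans (traj.eps_anti (by omega) (Nat.succ_le_succ hij))) ?_
    rw [← hCdef, ← hDsq]
    gcongr
  have hradius : ∀ i, k ≤ i → i ≤ j →
      min (r k * γ₂ * (ω₂ * γ₂) ^ (i - k)) (γ₂ * (D / ω₁)) ≤ γ₂ * r i := by
    intro i hki
    induction i, hki using Nat.le_induction with
    | base =>
      intro _
      rw [Nat.sub_self, pow_zero, mul_one, mul_comm (r k)]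
      exact min_le_left _ _
    | succ i hki ih =>
      intro hij
      have hi := hk.trans hki
      have ih := ih (by omega)
      rcases lt_or_ge ‖d i‖ D with hdi | hdi
      · obtain ⟨hρ, hrd⟩ := hshort i hki (by omega) hdi
        have hω₂ : 0 < ω₂ := hω₁0.trans_le hω₂
        calc min (r k * γ₂ * (ω₂ * γ₂) ^ (i + 1 - k)) (γ₂ * (D / ω₁))
            ≤ min (ω₂ * γ₂ * (r k * γ₂ * (ω₂ * γ₂) ^ (i - k))) (ω₂ * γ₂ * (γ₂ * (D / ω₁))) := by
              refine min_le_min (le_of_eq ?_) (le_mul_of_one_le_left (by positivity) hω₂γ₂)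
              rw [Nat.succ_sub hki, pow_succ]
              ring
          _ = ω₂ * γ₂ * min (r k * γ₂ * (ω₂ * γ₂) ^ (i - k)) (γ₂ * (D / ω₁)) :=
              (mul_min_of_nonneg _ _ (by positivity)).symm
          _ ≤ ω₂ * γ₂ * ‖d i‖ := by gcongr; exact ih.trans hrd
          _ = γ₂ * (ω₂ * ‖d i‖) := by ring
          _ ≤ γ₂ * r (i + 1) := by
              rw [traj.radius_succ i hi hρ]
              gcongr
              exact le_max_left _ _
      · refine (min_le_right _ _).trans ?_
        gcongr
        refine le_trans ?_ (traj.radius_div_le hω₁ hi)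
        gcongr
        exact hdi.trans (traj.sub_rad i hi)
  rcases lt_or_ge ‖d j‖ D with hdj | hdj
  · exact (hradius j hkj le_rfl).trans (hshort j hkj le_rfl hdj).2
  · refine (min_le_right _ _).trans (le_trans ?_ hdj)
    exact (mul_le_of_le_one_left (by positivity) hγ₂.2).trans (div_le_self hD0.le hω₁.le)
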